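/- arXiv:1307.1156 — 2 statements merged into one kernel-verified Lean document; each statement's English description precedes it below -/
import Mathlib

section
/- Let μ be a C₀-nice measure and A > 1. For each dyadic square Q let Ψ^μ_{Q,A} be the set of Lipschitz ψ with supp(ψ) ⊂ B(z_Q, Aℓ(Q)), ‖ψ‖_Lip ≤ ℓ(Q)^{-3/2}, and ∫ψ dμ = 0. Then for any choice ψ_Q ∈ Ψ^μ_{Q,A} (Q ∈ 𝒟) and any square-summable sequence (a_Q), we have ‖Σ_Q a_Q ψ_Q‖²_{L²(μ)} ≤ C(C₀)A⁵ Σ_Q |a_Q|², i.e., {Ψ^μ_{Q,A}} is a Riesz family with constant C(C₀)A⁵. -/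
open MeasureTheory Metric Complex

/-- The center of the dyadic square `[k 2^j, (k+1) 2^j) × [l 2^j, (l+1) 2^j)`. -/
noncomputable def dyadicCenter (Q : ℤ × ℤ × ℤ) : ℂ :=
  ⟨(Q.2.1 + 1 / 2) * (2 : ℝ) ^ Q.1, (Q.2.2 + 1 / 2) * (2 : ℝ) ^ Q.1⟩

/-- The side length of the dyadic square indexed by `Q = (j, k, l)`. -/
noncomputable def dyadicSide (Q : ℤ × ℤ × ℤ) : ℝ := (2 : ℝ) ^ Q.1

lemma dyadicSide_pos (Q : ℤ × ℤ × ℤ) : 0 < dyadicSide Q := by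
  unfold dyadicSide; positivity

lemma sqrt_two_pos : (0 : ℝ) < √2 := by positivity

lemma dyadicSide_eq_sqrt_two_zpow (Q : ℤ × ℤ × ℤ) : dyadicSide Q = √2 ^ (2 * Q.1) := by
  rw [zpow_mul, dyadicSide]
  norm_num

lemma dyadicSide_rpow (Q : ℤ × ℤ × ℤ) :
    dyadicSide Q ^ (-(3 / 2) : ℝ) = √2 ^ (-3 * Q.1) := by
  rw [dyadicSide, ← Real.rpow_intCast, ← Real.rpow_intCast, Real.sqrt_eq_rpow,
    ← Real.rpow_mul (by norm_num), ← Real.rpow_mul (by norm_num)]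
  push_cast
  ring_nf

/-- An interval of length `2 * B` contains at most `2 * B + 1` integers. -/
lemma card_Icc_ceil_floor_le (x B : ℝ) (hB : 1 ≤ B) :
    ((Finset.Icc ⌈x - B⌉ ⌊x + B⌋).card : ℝ) ≤ 3 * B := by
  rw [Int.card_Icc]
  have h1 := Int.le_ceil (x - B)
  have h2 := Int.floor_le (x + B)
  rcases le_total 0 (⌊x + B⌋ + 1 - ⌈x - B⌉) with h | h
  · have : (((⌊x + B⌋ + 1 - ⌈x - B⌉).toNat : ℤ) : ℝ) = ((⌊x + B⌋ + 1 - ⌈x - B⌉ : ℤ) : ℝ) := by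
      rw [Int.toNat_of_nonneg h]
    rw [Int.cast_natCast] at this
    rw [this]
    push_cast
    linarith
  · rw [Int.toNat_of_nonpos h]
    push_cast
    linarith

/-- Few dyadic squares of a given generation have their center close to a given point. -/
lemma card_dyadic_le (s : Finset (ℤ × ℤ × ℤ)) (j : ℤ) (z : ℂ) (B : ℝ) (hB : 1 ≤ B)
    (hs : ∀ Q ∈ s, Q.1 = j ∧ ‖z - dyadicCenter Q‖ < B * 2 ^ j) : (s.card : ℝ) ≤ 9 * B ^ 2 := by
  have hpos : (0 : ℝ) < 2 ^ j := by positivity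
  set x := z.re / 2 ^ j - 1 / 2
  set y := z.im / 2 ^ j - 1 / 2
  have key : ∀ (u : ℝ) (k : ℤ), |u - (k + 1 / 2) * 2 ^ j| < B * 2 ^ j →
      k ∈ Finset.Icc ⌈u / 2 ^ j - 1 / 2 - B⌉ ⌊u / 2 ^ j - 1 / 2 + B⌋ := by
    intro u k h
    have hu : u = u / 2 ^ j * 2 ^ j := by field_simp
    rw [hu, ← sub_mul, abs_mul, abs_of_pos hpos, mul_lt_mul_iff_left₀ hpos, abs_lt] at h
    rw [Finset.mem_Icc, Int.ceil_le, Int.le_floor]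
    constructor <;> linarith
  have hsub : s ⊆ {j} ×ˢ (Finset.Icc ⌈x - B⌉ ⌊x + B⌋ ×ˢ Finset.Icc ⌈y - B⌉ ⌊y + B⌋) := by
    intro Q hQ
    obtain ⟨h1, h2⟩ := hs Q hQ
    rw [Finset.mem_product, Finset.mem_product, Finset.mem_singleton]
    refine ⟨h1, key _ _ ?_, key _ _ ?_⟩
    · refine lt_of_le_of_lt ?_ h2
      simpa [dyadicCenter, h1] using abs_re_le_norm (z - dyadicCenter Q)
    · refine lt_of_le_of_lt ?_ h2
      simpa [dyadicCenter, h1] using abs_im_le_norm (z - dyadicCenter Q)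
  have hc := Finset.card_le_card hsub
  rw [Finset.card_product, Finset.card_product, Finset.card_singleton, one_mul] at hc
  calc (s.card : ℝ) ≤ ((Finset.Icc ⌈x - B⌉ ⌊x + B⌋).card : ℝ) *
        (Finset.Icc ⌈y - B⌉ ⌊y + B⌋).card := by exact_mod_cast hc
    _ ≤ (3 * B) * (3 * B) := by
        gcongr <;> exact card_Icc_ceil_floor_le _ _ hB
    _ = 9 * B ^ 2 := by ring

lemma inv_sqrt_two_pow_natAbs {m : ℤ} (hm : m ≤ 0) : (√2)⁻¹ ^ m.natAbs = √2 ^ m := by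
  rw [← zpow_natCast, Int.natCast_natAbs, abs_of_nonpos hm, inv_zpow', neg_neg]

lemma summable_inv_sqrt_two_pow_natAbs : Summable fun m : ℤ => (√2)⁻¹ ^ m.natAbs := by
  have h : Summable fun n : ℕ => (√2)⁻¹ ^ n := by
    refine summable_geometric_of_lt_one (by positivity) ?_
    refine inv_lt_one_of_one_lt₀ ?_
    rw [Real.lt_sqrt] <;> norm_num
  refine Summable.of_nat_of_neg ?_ ?_ <;> simpa using h

lemma sum_inv_sqrt_two_pow_natAbs_le (T : Finset ℤ) (j : ℤ) :
    ∑ k ∈ T, (√2)⁻¹ ^ (k - j).natAbs ≤ ∑' m : ℤ, (√2)⁻¹ ^ m.natAbs := by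
  rw [← (Equiv.subRight j).tsum_eq fun m : ℤ => (√2)⁻¹ ^ m.natAbs]
  exact ((Equiv.subRight j).summable_iff.2 summable_inv_sqrt_two_pow_natAbs).sum_le_tsum T
    fun _ _ => by positivity

/-- A `C₀`-nice measure is finite on compact sets. -/
lemma isFiniteMeasureOnCompacts_of_ball_le {μ : Measure ℂ} {C₀ : ℝ}
    (hμ : ∀ (z : ℂ) (r : ℝ), 0 < r → μ (ball z r) ≤ ENNReal.ofReal (C₀ * r)) :
    IsFiniteMeasureOnCompacts μ := by
  refine ⟨fun K hK => ?_⟩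
  obtain ⟨r, hr, hKr⟩ := hK.isBounded.subset_ball_lt 0 0
  exact (measure_mono hKr).trans_lt ((hμ 0 r hr).trans_lt ENNReal.ofReal_lt_top)

lemma measureReal_ball_le {μ : Measure ℂ} {C₀ : ℝ} (hC₀ : 0 < C₀)
    (hμ : ∀ (z : ℂ) (r : ℝ), 0 < r → μ (ball z r) ≤ ENNReal.ofReal (C₀ * r))
    (z : ℂ) {r : ℝ} (hr : 0 < r) : μ.real (ball z r) ≤ C₀ * r :=
  ENNReal.toReal_le_of_le_ofReal (by positivity) (hμ z r hr)

/-- Total mass of the dilated squares of generation `j` contained in a fixed ball. -/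
lemma sum_measureReal_ball_le {μ : Measure ℂ} [IsFiniteMeasureOnCompacts μ]
    (s : Finset (ℤ × ℤ × ℤ)) (j : ℤ) {A : ℝ} (hA : 1 ≤ A) (w : ℂ) (r : ℝ)
    (hs : ∀ Q ∈ s, Q.1 = j ∧ ball (dyadicCenter Q) (A * dyadicSide Q) ⊆ ball w r) :
    ∑ Q ∈ s, μ.real (ball (dyadicCenter Q) (A * dyadicSide Q)) ≤
      9 * A ^ 2 * μ.real (ball w r) := by
  classical
  have hint : ∀ (v : ℂ) (t : ℝ) (c : ℝ), Integrable ((ball v t).indicator fun _ => c) μ :=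
    fun v t c => (integrable_indicator_iff measurableSet_ball).2
      (integrableOn_const measure_ball_lt_top.ne)
  have h1 : ∀ Q : ℤ × ℤ × ℤ, μ.real (ball (dyadicCenter Q) (A * dyadicSide Q)) =
      ∫ z, (ball (dyadicCenter Q) (A * dyadicSide Q)).indicator (fun _ => (1 : ℝ)) z ∂μ := by
    intro Q
    rw [integral_indicator measurableSet_ball]
    simp
  have h2 : 9 * A ^ 2 * μ.real (ball w r) =
      ∫ z, (ball w r).indicator (fun _ => 9 * A ^ 2) z ∂μ := by
    rw [integral_indicator measurableSet_ball]
    simp [mul_comm]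
  simp_rw [h1]
  rw [h2, ← integral_finsetSum _ fun Q _ => hint _ _ _]
  refine integral_mono (integrable_finsetSum _ fun Q _ => hint _ _ _) (hint _ _ _) fun z => ?_
  simp only [Set.indicator_apply]
  rw [Finset.sum_boole]
  split_ifs with hz
  · refine card_dyadic_le _ j z A hA fun Q hQ => ?_
    rw [Finset.mem_filter, mem_ball, dist_eq_norm, dyadicSide] at hQ
    obtain ⟨hQs, hQz⟩ := hQ
    rw [(hs Q hQs).1] at hQz
    exact ⟨(hs Q hQs).1, hQz⟩
  · rw [Finset.filter_false_of_mem fun Q hQ h => hz ((hs Q hQ).2 h)]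
    simp

/-- The functions `ψ Q` belong to the family attached to `μ` and `A`. -/
structure IsDyadicWavelet (μ : Measure ℂ) (A : ℝ) (ψ : ℤ × ℤ × ℤ → ℂ → ℂ) : Prop where
  support_subset : ∀ Q, Function.support (ψ Q) ⊆ ball (dyadicCenter Q) (A * dyadicSide Q)
  lipschitz : ∀ Q, ∀ z ξ : ℂ, ‖ψ Q z - ψ Q ξ‖ ≤ dyadicSide Q ^ (-(3 / 2) : ℝ) * ‖z - ξ‖
  integral_eq_zero : ∀ Q, ∫ z, ψ Q z ∂μ = 0

namespace IsDyadicWavelet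

variable {μ : Measure ℂ} {A C₀ : ℝ} {ψ : ℤ × ℤ × ℤ → ℂ → ℂ}

lemma continuous (h : IsDyadicWavelet μ A ψ) (Q : ℤ × ℤ × ℤ) : Continuous (ψ Q) := by
  have : LipschitzWith (dyadicSide Q ^ (-(3 / 2) : ℝ)).toNNReal (ψ Q) :=
    LipschitzWith.of_dist_le' fun z ξ => by
      rw [dist_eq_norm, dist_eq_norm]; exact h.lipschitz Q z ξ
  exact this.continuous

lemma hasCompactSupport (h : IsDyadicWavelet μ A ψ) (Q : ℤ × ℤ × ℤ) :
    HasCompactSupport (ψ Q) :=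
  HasCompactSupport.of_support_subset_isCompact
    (isCompact_closedBall (dyadicCenter Q) (A * dyadicSide Q))
    ((h.support_subset Q).trans ball_subset_closedBall)

lemma integrable [IsFiniteMeasureOnCompacts μ] (h : IsDyadicWavelet μ A ψ) (Q : ℤ × ℤ × ℤ) :
    Integrable (ψ Q) μ :=
  (h.continuous Q).integrable_of_hasCompactSupport (h.hasCompactSupport Q)

lemma integrable_mul_conj [IsFiniteMeasureOnCompacts μ] (h : IsDyadicWavelet μ A ψ)
    (Q R : ℤ × ℤ × ℤ) : Integrable (fun z => ψ Q z * starRingEnd ℂ (ψ R z)) μ :=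
  ((h.continuous Q).mul (continuous_conj.comp (h.continuous R))).integrable_of_hasCompactSupport
    (h.hasCompactSupport Q).mul_right

lemma eq_zero_of_notMem (h : IsDyadicWavelet μ A ψ) {Q : ℤ × ℤ × ℤ} {z : ℂ}
    (hz : z ∉ ball (dyadicCenter Q) (A * dyadicSide Q)) : ψ Q z = 0 := by
  by_contra hne
  exact hz (h.support_subset Q hne)

lemma norm_le (h : IsDyadicWavelet μ A ψ) (hA : 1 < A) {Q : ℤ × ℤ × ℤ} {z : ℂ}
    (hz : z ∈ ball (dyadicCenter Q) (A * dyadicSide Q)) :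
    ‖ψ Q z‖ ≤ 2 * A * √2 ^ (-Q.1) := by
  have hl := dyadicSide_pos Q
  have hr : 0 < A * dyadicSide Q := by positivity
  set w : ℂ := dyadicCenter Q + (A * dyadicSide Q : ℝ)
  have hw : ψ Q w = 0 := by
    refine h.eq_zero_of_notMem ?_
    rw [mem_ball, dist_eq_norm, add_sub_cancel_left, norm_real, Real.norm_eq_abs, abs_of_pos hr]
    exact lt_irrefl _
  have hzw : ‖z - w‖ ≤ 2 * (A * dyadicSide Q) := by
    rw [mem_ball, dist_eq_norm] at hz
    calc ‖z - w‖ = ‖(z - dyadicCenter Q) - (A * dyadicSide Q : ℝ)‖ := by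
          congr 1; simp only [w]; ring
      _ ≤ ‖z - dyadicCenter Q‖ + ‖((A * dyadicSide Q : ℝ) : ℂ)‖ := norm_sub_le _ _
      _ ≤ 2 * (A * dyadicSide Q) := by
          rw [norm_real, Real.norm_eq_abs, abs_of_pos hr]; linarith
  have h1 := h.lipschitz Q z w
  rw [hw, sub_zero] at h1
  refine h1.trans ?_
  rw [dyadicSide_rpow]
  calc √2 ^ (-3 * Q.1) * ‖z - w‖ ≤ √2 ^ (-3 * Q.1) * (2 * (A * dyadicSide Q)) := by gcongr
    _ = 2 * A * (√2 ^ (-3 * Q.1) * √2 ^ (2 * Q.1)) := by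
        rw [dyadicSide_eq_sqrt_two_zpow]; ring
    _ = 2 * A * √2 ^ (-Q.1) := by
        rw [← zpow_add₀ sqrt_two_pos.ne']; congr 2; ring

/-- Disjointly supported members are orthogonal. -/
lemma integral_mul_conj_eq_zero (h : IsDyadicWavelet μ A ψ) {Q R : ℤ × ℤ × ℤ}
    (hQR : A * dyadicSide Q + A * dyadicSide R ≤ ‖dyadicCenter Q - dyadicCenter R‖) :
    ∫ z, ψ Q z * starRingEnd ℂ (ψ R z) ∂μ = 0 := by
  refine integral_eq_zero_of_ae (Filter.Eventually.of_forall fun z => ?_)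
  have hd := ball_disjoint_ball (x := dyadicCenter Q) (y := dyadicCenter R)
    (by rwa [dist_eq_norm])
  by_cases hz : z ∈ ball (dyadicCenter Q) (A * dyadicSide Q)
  · simp [h.eq_zero_of_notMem (Set.disjoint_left.1 hd hz)]
  · simp [h.eq_zero_of_notMem hz]

/-- The cancellation of `ψ Q` against the smoothness of `ψ R`. -/
lemma norm_integral_mul_conj_le [IsFiniteMeasureOnCompacts μ] (h : IsDyadicWavelet μ A ψ)
    (hA : 1 < A) (Q R : ℤ × ℤ × ℤ) :
    ‖∫ z, ψ Q z * starRingEnd ℂ (ψ R z) ∂μ‖ ≤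
      2 * A ^ 2 * √2 ^ (Q.1 - 3 * R.1) *
        μ.real (ball (dyadicCenter Q) (A * dyadicSide Q)) := by
  set B := ball (dyadicCenter Q) (A * dyadicSide Q)
  set c := starRingEnd ℂ (ψ R (dyadicCenter Q))
  have h1 : ∫ z, ψ Q z * starRingEnd ℂ (ψ R z) ∂μ =
      ∫ z, ψ Q z * (starRingEnd ℂ (ψ R z) - c) ∂μ := by
    simp_rw [mul_sub]
    rw [integral_sub (h.integrable_mul_conj Q R) ((h.integrable Q).mul_const c),
      integral_mul_const, h.integral_eq_zero Q, zero_mul, sub_zero]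
  have h2 : ∫ z, ψ Q z * (starRingEnd ℂ (ψ R z) - c) ∂μ =
      ∫ z in B, ψ Q z * (starRingEnd ℂ (ψ R z) - c) ∂μ := by
    refine (setIntegral_eq_integral_of_forall_compl_eq_zero fun z hz => ?_).symm
    rw [h.eq_zero_of_notMem hz, zero_mul]
  rw [h1, h2]
  refine norm_setIntegral_le_of_norm_le_const measure_ball_lt_top fun z hz => ?_
  have hl := dyadicSide_pos Q
  have hz' : ‖z - dyadicCenter Q‖ ≤ A * dyadicSide Q := by
    rw [← dist_eq_norm]; exact (mem_ball.1 hz).le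
  rw [norm_mul, ← map_sub, norm_conj]
  calc ‖ψ Q z‖ * ‖ψ R z - ψ R (dyadicCenter Q)‖
      ≤ (2 * A * √2 ^ (-Q.1)) * (√2 ^ (-3 * R.1) * (A * dyadicSide Q)) := by
        gcongr
        · exact h.norm_le hA hz
        · refine (h.lipschitz R _ _).trans ?_
          rw [dyadicSide_rpow]
          gcongr
    _ = 2 * A ^ 2 * (√2 ^ (-Q.1) * √2 ^ (-3 * R.1) * √2 ^ (2 * Q.1)) := by
        rw [dyadicSide_eq_sqrt_two_zpow]; ring
    _ = 2 * A ^ 2 * √2 ^ (Q.1 - 3 * R.1) := by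
        rw [← zpow_add₀ sqrt_two_pos.ne', ← zpow_add₀ sqrt_two_pos.ne']; congr 2; ring

lemma norm_integral_mul_conj_comm (Q R : ℤ × ℤ × ℤ) :
    ‖∫ z, ψ Q z * starRingEnd ℂ (ψ R z) ∂μ‖ = ‖∫ z, ψ R z * starRingEnd ℂ (ψ Q z) ∂μ‖ := by
  rw [← norm_conj, ← integral_conj]
  simp [mul_comm]

/-- Correlations of `ψ Q` with the members of a coarser generation. -/
lemma sum_norm_integral_mul_conj_le_of_le (hC₀ : 0 < C₀)
    (hμ : ∀ (z : ℂ) (r : ℝ), 0 < r → μ (ball z r) ≤ ENNReal.ofReal (C₀ * r))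
    (h : IsDyadicWavelet μ A ψ) (hA : 1 < A) (s : Finset (ℤ × ℤ × ℤ)) (Q : ℤ × ℤ × ℤ) (k : ℤ)
    (hs : ∀ R ∈ s, R.1 = k) (hk : Q.1 ≤ k) :
    ∑ R ∈ s, ‖∫ z, ψ Q z * starRingEnd ℂ (ψ R z) ∂μ‖ ≤
      72 * C₀ * A ^ 5 * (√2)⁻¹ ^ (k - Q.1).natAbs := by
  classical
  have := isFiniteMeasureOnCompacts_of_ball_le hμ
  have hl := dyadicSide_pos Q
  have hone : (1 : ℝ) ≤ √2 := by rw [Real.one_le_sqrt]; norm_num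
  set p : ℤ × ℤ × ℤ → Prop := fun R =>
    ‖dyadicCenter Q - dyadicCenter R‖ < A * dyadicSide Q + A * dyadicSide R
  rw [← Finset.sum_filter_of_ne (p := p) fun R _ hne => by
    by_contra hp
    exact hne (by rw [h.integral_mul_conj_eq_zero (not_lt.1 hp), norm_zero])]
  have hcard : ((s.filter p).card : ℝ) ≤ 9 * (2 * A) ^ 2 := by
    refine card_dyadic_le _ k (dyadicCenter Q) (2 * A) (by linarith) fun R hR => ?_
    obtain ⟨hRs, hRp⟩ := Finset.mem_filter.1 hR
    refine ⟨hs R hRs, hRp.trans_le ?_⟩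
    have hQk : dyadicSide Q ≤ 2 ^ k := zpow_le_zpow_right₀ (by norm_num) hk
    have hRk : dyadicSide R = 2 ^ k := by rw [dyadicSide, hs R hRs]
    rw [hRk]
    nlinarith
  have hterm : ∀ R ∈ s.filter p, ‖∫ z, ψ Q z * starRingEnd ℂ (ψ R z) ∂μ‖ ≤
      2 * C₀ * A ^ 3 * √2 ^ (3 * (Q.1 - k)) := by
    intro R hR
    have hRk := hs R (Finset.mem_filter.1 hR).1
    calc _ ≤ 2 * A ^ 2 * √2 ^ (Q.1 - 3 * R.1) *
          μ.real (ball (dyadicCenter Q) (A * dyadicSide Q)) := h.norm_integral_mul_conj_le hA Q R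
      _ ≤ 2 * A ^ 2 * √2 ^ (Q.1 - 3 * R.1) * (C₀ * (A * dyadicSide Q)) := by
          gcongr
          exact measureReal_ball_le hC₀ hμ _ (by positivity)
      _ = 2 * C₀ * A ^ 3 * (√2 ^ (Q.1 - 3 * k) * √2 ^ (2 * Q.1)) := by
          rw [dyadicSide_eq_sqrt_two_zpow, hRk]; ring
      _ = _ := by rw [← zpow_add₀ sqrt_two_pos.ne']; congr 2; ring
  calc _ ≤ ((s.filter p).card : ℝ) * (2 * C₀ * A ^ 3 * √2 ^ (3 * (Q.1 - k))) := by
        rw [← nsmul_eq_mul]; exact Finset.sum_le_card_nsmul _ _ _ hterm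
    _ ≤ (9 * (2 * A) ^ 2) * (2 * C₀ * A ^ 3 * √2 ^ (Q.1 - k)) := by
        gcongr
        linarith
    _ = 72 * C₀ * A ^ 5 * (√2)⁻¹ ^ (k - Q.1).natAbs := by
        rw [← Int.natAbs_neg, neg_sub, inv_sqrt_two_pow_natAbs (by linarith)]; ring

/-- Correlations of `ψ R` with the members of a finer generation. -/
lemma sum_norm_integral_mul_conj_le_of_ge (hC₀ : 0 < C₀)
    (hμ : ∀ (z : ℂ) (r : ℝ), 0 < r → μ (ball z r) ≤ ENNReal.ofReal (C₀ * r))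
    (h : IsDyadicWavelet μ A ψ) (hA : 1 < A) (s : Finset (ℤ × ℤ × ℤ)) (R : ℤ × ℤ × ℤ) (j : ℤ)
    (hs : ∀ Q ∈ s, Q.1 = j) (hj : j ≤ R.1) :
    ∑ Q ∈ s, ‖∫ z, ψ Q z * starRingEnd ℂ (ψ R z) ∂μ‖ ≤
      72 * C₀ * A ^ 5 * (√2)⁻¹ ^ (j - R.1).natAbs := by
  classical
  have := isFiniteMeasureOnCompacts_of_ball_le hμ
  have hl := dyadicSide_pos R
  set p : ℤ × ℤ × ℤ → Prop := fun Q =>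
    ‖dyadicCenter Q - dyadicCenter R‖ < A * dyadicSide Q + A * dyadicSide R
  rw [← Finset.sum_filter_of_ne (p := p) fun Q _ hne => by
    by_contra hp
    exact hne (by rw [h.integral_mul_conj_eq_zero (not_lt.1 hp), norm_zero])]
  have hmass : ∑ Q ∈ s.filter p, μ.real (ball (dyadicCenter Q) (A * dyadicSide Q)) ≤
      9 * A ^ 2 * μ.real (ball (dyadicCenter R) (3 * (A * dyadicSide R))) := by
    refine sum_measureReal_ball_le _ j hA.le _ _ fun Q hQ => ?_
    obtain ⟨hQs, hQp⟩ := Finset.mem_filter.1 hQ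
    refine ⟨hs Q hQs, ball_subset_ball' ?_⟩
    have hQR : dyadicSide Q ≤ dyadicSide R :=
      zpow_le_zpow_right₀ (by norm_num) ((hs Q hQs).trans_le hj)
    have hQR' : A * dyadicSide Q ≤ A * dyadicSide R := by gcongr
    rw [dist_eq_norm]
    linarith [show _ < _ from hQp]
  calc _ ≤ ∑ Q ∈ s.filter p, 2 * A ^ 2 * √2 ^ (j - 3 * R.1) *
          μ.real (ball (dyadicCenter Q) (A * dyadicSide Q)) := by
        refine Finset.sum_le_sum fun Q hQ => ?_
        rw [← hs Q (Finset.mem_filter.1 hQ).1]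
        exact h.norm_integral_mul_conj_le hA Q R
    _ ≤ 2 * A ^ 2 * √2 ^ (j - 3 * R.1) * (9 * A ^ 2 * (C₀ * (3 * (A * dyadicSide R)))) := by
        rw [← Finset.mul_sum]
        gcongr
        refine hmass.trans ?_
        gcongr
        exact measureReal_ball_le hC₀ hμ _ (by positivity)
    _ = 54 * C₀ * A ^ 5 * (√2 ^ (j - 3 * R.1) * √2 ^ (2 * R.1)) := by
        rw [dyadicSide_eq_sqrt_two_zpow]; ring
    _ = 54 * C₀ * A ^ 5 * (√2)⁻¹ ^ (j - R.1).natAbs := by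
        rw [← zpow_add₀ sqrt_two_pos.ne', inv_sqrt_two_pow_natAbs (by linarith)]
        congr 2
        ring
    _ ≤ 72 * C₀ * A ^ 5 * (√2)⁻¹ ^ (j - R.1).natAbs := by
        gcongr
        norm_num

/-- The row sums of the Gram matrix are bounded. -/
lemma sum_norm_integral_mul_conj_le (hC₀ : 0 < C₀)
    (hμ : ∀ (z : ℂ) (r : ℝ), 0 < r → μ (ball z r) ≤ ENNReal.ofReal (C₀ * r))
    (h : IsDyadicWavelet μ A ψ) (hA : 1 < A) (s : Finset (ℤ × ℤ × ℤ)) (Q : ℤ × ℤ × ℤ) :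
    ∑ R ∈ s, ‖∫ z, ψ Q z * starRingEnd ℂ (ψ R z) ∂μ‖ ≤
      72 * C₀ * (∑' m : ℤ, (√2)⁻¹ ^ m.natAbs) * A ^ 5 := by
  classical
  rw [← Finset.sum_fiberwise_of_maps_to (t := s.image Prod.fst) (g := Prod.fst)
    fun R hR => Finset.mem_image_of_mem _ hR]
  calc _ ≤ ∑ k ∈ s.image Prod.fst, 72 * C₀ * A ^ 5 * (√2)⁻¹ ^ (k - Q.1).natAbs := by
        refine Finset.sum_le_sum fun k _ => ?_
        have hs : ∀ R ∈ s.filter (fun R => R.1 = k), R.1 = k := fun R hR =>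
          (Finset.mem_filter.1 hR).2
        rcases le_total Q.1 k with hk | hk
        · exact h.sum_norm_integral_mul_conj_le_of_le hC₀ hμ hA _ Q k hs hk
        · simp_rw [norm_integral_mul_conj_comm (μ := μ) Q]
          exact h.sum_norm_integral_mul_conj_le_of_ge hC₀ hμ hA _ Q k hs hk
    _ ≤ 72 * C₀ * A ^ 5 * ∑' m : ℤ, (√2)⁻¹ ^ m.natAbs := by
        rw [← Finset.mul_sum]
        gcongr
        exact sum_inv_sqrt_two_pow_natAbs_le _ _
    _ = _ := by ring

end IsDyadicWavelet

/-- Schur's test for a symmetric matrix with nonnegative entries. -/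
lemma sum_mul_mul_le_of_symm {ι : Type*} (s : Finset ι) (x : ι → ℝ) (M : ι → ι → ℝ) (K : ℝ)
    (hM : ∀ i j, 0 ≤ M i j) (hsymm : ∀ i j, M i j = M j i) (hK : ∀ i, ∑ j ∈ s, M i j ≤ K) :
    ∑ i ∈ s, ∑ j ∈ s, x i * x j * M i j ≤ K * ∑ i ∈ s, x i ^ 2 := by
  have h1 : ∑ i ∈ s, ∑ j ∈ s, x i ^ 2 * M i j ≤ K * ∑ i ∈ s, x i ^ 2 := by
    rw [Finset.mul_sum]
    refine Finset.sum_le_sum fun i _ => ?_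
    rw [← Finset.mul_sum, mul_comm]
    gcongr
    exact hK i
  have h2 : ∑ i ∈ s, ∑ j ∈ s, x j ^ 2 * M i j = ∑ i ∈ s, ∑ j ∈ s, x i ^ 2 * M i j := by
    rw [Finset.sum_comm]
    simp_rw [hsymm]
  have h3 : ∑ i ∈ s, ∑ j ∈ s, x i * x j * M i j ≤
      ∑ i ∈ s, ∑ j ∈ s, (x i ^ 2 * M i j + x j ^ 2 * M i j) / 2 := by
    refine Finset.sum_le_sum fun i _ => Finset.sum_le_sum fun j _ => ?_
    nlinarith [mul_nonneg (sq_nonneg (x i - x j)) (hM i j)]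
  simp_rw [← Finset.sum_div, Finset.sum_add_distrib] at h3
  linarith

namespace IsDyadicWavelet

variable {μ : Measure ℂ} {A C₀ : ℝ} {ψ : ℤ × ℤ × ℤ → ℂ → ℂ}

lemma integrable_norm_sum_sq [IsFiniteMeasureOnCompacts μ] (h : IsDyadicWavelet μ A ψ)
    (a : ℤ × ℤ × ℤ → ℂ) (s : Finset (ℤ × ℤ × ℤ)) :
    Integrable (fun z => ‖∑ Q ∈ s, a Q * ψ Q z‖ ^ 2) μ := by
  have hc : Continuous fun z => ∑ Q ∈ s, a Q * ψ Q z :=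
    continuous_finsetSum _ fun Q _ => continuous_const.mul (h.continuous Q)
  refine (hc.norm.pow 2).integrable_of_hasCompactSupport ?_
  refine HasCompactSupport.of_support_subset_isCompact
    (s.isCompact_biUnion fun Q _ => h.hasCompactSupport Q) fun z hz => ?_
  by_contra hz'
  refine hz ?_
  have : ∑ Q ∈ s, a Q * ψ Q z = 0 := Finset.sum_eq_zero fun Q hQ => by
    rw [image_eq_zero_of_notMem_tsupport fun hQz => hz' (Set.mem_biUnion hQ hQz), mul_zero]
  simp [this]

/-- The Riesz bound for finite linear combinations. -/
lemma integral_norm_sum_sq_le (hC₀ : 0 < C₀)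
    (hμ : ∀ (z : ℂ) (r : ℝ), 0 < r → μ (ball z r) ≤ ENNReal.ofReal (C₀ * r))
    (h : IsDyadicWavelet μ A ψ) (hA : 1 < A) (a : ℤ × ℤ × ℤ → ℂ) (s : Finset (ℤ × ℤ × ℤ)) :
    ∫ z, ‖∑ Q ∈ s, a Q * ψ Q z‖ ^ 2 ∂μ ≤
      72 * C₀ * (∑' m : ℤ, (√2)⁻¹ ^ m.natAbs) * A ^ 5 * ∑ Q ∈ s, ‖a Q‖ ^ 2 := by
  have := isFiniteMeasureOnCompacts_of_ball_le hμ
  have hexp : ((∫ z, ‖∑ Q ∈ s, a Q * ψ Q z‖ ^ 2 ∂μ : ℝ) : ℂ) =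
      ∑ Q ∈ s, ∑ R ∈ s, a Q * starRingEnd ℂ (a R) *
        ∫ z, ψ Q z * starRingEnd ℂ (ψ R z) ∂μ := by
    rw [← integral_complex_ofReal]
    have hpt : ∀ z, ((‖∑ Q ∈ s, a Q * ψ Q z‖ ^ 2 : ℝ) : ℂ) =
        ∑ Q ∈ s, ∑ R ∈ s, a Q * starRingEnd ℂ (a R) * (ψ Q z * starRingEnd ℂ (ψ R z)) := by
      intro z
      rw [ofReal_pow, ← mul_conj', map_sum, Finset.sum_mul_sum]
      refine Finset.sum_congr rfl fun Q _ => Finset.sum_congr rfl fun R _ => ?_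
      rw [map_mul]; ring
    have hint : ∀ Q R, Integrable
        (fun z => a Q * starRingEnd ℂ (a R) * (ψ Q z * starRingEnd ℂ (ψ R z))) μ :=
      fun Q R => (h.integrable_mul_conj Q R).const_mul _
    refine (integral_congr_ae (Filter.Eventually.of_forall hpt)).trans ?_
    rw [integral_finsetSum _ fun Q _ => integrable_finsetSum _ fun R _ => hint Q R]
    refine Finset.sum_congr rfl fun Q _ => ?_
    rw [integral_finsetSum _ fun R _ => hint Q R]
    exact Finset.sum_congr rfl fun R _ => integral_const_mul _ _
  calc ∫ z, ‖∑ Q ∈ s, a Q * ψ Q z‖ ^ 2 ∂μ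
      ≤ ‖((∫ z, ‖∑ Q ∈ s, a Q * ψ Q z‖ ^ 2 ∂μ : ℝ) : ℂ)‖ := by
        rw [norm_real]; exact Real.le_norm_self _
    _ ≤ ∑ Q ∈ s, ∑ R ∈ s, ‖a Q‖ * ‖a R‖ * ‖∫ z, ψ Q z * starRingEnd ℂ (ψ R z) ∂μ‖ := by
        rw [hexp]
        refine norm_sum_le_of_le _ fun Q _ => norm_sum_le_of_le _ fun R _ => ?_
        rw [norm_mul, norm_mul, norm_conj]
    _ ≤ _ := sum_mul_mul_le_of_symm s (fun Q => ‖a Q‖) _ _ (fun _ _ => norm_nonneg _)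
        norm_integral_mul_conj_comm fun Q => h.sum_norm_integral_mul_conj_le hC₀ hμ hA s Q

end IsDyadicWavelet

/-- Fatou's lemma for the pointwise, possibly divergent, sum of a series of functions. -/
lemma integral_norm_tsum_sq_le_of_forall_finset {X ι : Type*} [MeasurableSpace X] [Countable ι]
    {μ : Measure X} (f : ι → X → ℂ) {K : ℝ} (hK : 0 ≤ K) (hf : ∀ i, Measurable (f i))
    (hint : ∀ s : Finset ι, Integrable (fun z => ‖∑ i ∈ s, f i z‖ ^ 2) μ)
    (hle : ∀ s : Finset ι, ∫ z, ‖∑ i ∈ s, f i z‖ ^ 2 ∂μ ≤ K) :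
    ∫ z, ‖∑' i, f i z‖ ^ 2 ∂μ ≤ K := by
  by_cases hm : AEStronglyMeasurable (fun z => ‖∑' i, f i z‖ ^ 2) μ
  swap
  · rwa [integral_non_aestronglyMeasurable hm]
  rw [integral_eq_lintegral_of_nonneg_ae (Filter.Eventually.of_forall fun z => by positivity) hm]
  refine ENNReal.toReal_le_of_le_ofReal hK ?_
  obtain ⟨u, hu⟩ := Filter.exists_seq_tendsto (Filter.atTop : Filter (Finset ι))
  calc ∫⁻ z, ENNReal.ofReal (‖∑' i, f i z‖ ^ 2) ∂μ
      ≤ ∫⁻ z, Filter.liminf (fun n => ENNReal.ofReal (‖∑ i ∈ u n, f i z‖ ^ 2))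
          Filter.atTop ∂μ := by
        refine lintegral_mono fun z => ?_
        by_cases hz : Summable fun i => f i z
        · have ht := ENNReal.tendsto_ofReal (((hz.hasSum.comp hu).norm).pow 2)
          exact ht.liminf_eq.ge
        · simp [tsum_eq_zero_of_not_summable hz]
    _ ≤ Filter.liminf (fun n => ∫⁻ z, ENNReal.ofReal (‖∑ i ∈ u n, f i z‖ ^ 2) ∂μ)
          Filter.atTop :=
        lintegral_liminf_le fun n => by fun_prop
    _ ≤ ENNReal.ofReal K := by
        refine Filter.liminf_le_of_le (by isBoundedDefault) fun b hb => ?_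
        obtain ⟨n, hn⟩ := hb.exists
        refine hn.trans ?_
        rw [← ofReal_integral_eq_lintegral_ofReal (hint (u n))
          (Filter.Eventually.of_forall fun z => by positivity)]
        exact ENNReal.ofReal_le_ofReal (hle _)

theorem riesz_family (C₀ : ℝ) (hC₀ : 0 < C₀) :
    ∃ C : ℝ, 0 < C ∧
      ∀ (μ : Measure ℂ),
        (∀ (z : ℂ) (r : ℝ), 0 < r → μ (ball z r) ≤ ENNReal.ofReal (C₀ * r)) →
        ∀ (A : ℝ), 1 < A →
        ∀ ψ : ℤ × ℤ × ℤ → ℂ → ℂ,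
          (∀ Q, Function.support (ψ Q) ⊆ ball (dyadicCenter Q) (A * dyadicSide Q)) →
          (∀ Q, ∀ z ξ : ℂ,
            ‖ψ Q z - ψ Q ξ‖ ≤ (dyadicSide Q) ^ (-(3/2) : ℝ) * ‖z - ξ‖) →
          (∀ Q, ∫ z, ψ Q z ∂μ = 0) →
        ∀ a : ℤ × ℤ × ℤ → ℂ, Summable (fun Q => ‖a Q‖ ^ 2) →
          ∫ z, ‖∑' Q, a Q * ψ Q z‖ ^ 2 ∂μ ≤ C * A ^ 5 * ∑' Q, ‖a Q‖ ^ 2 := by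
  have hS : 0 < ∑' m : ℤ, (√2)⁻¹ ^ m.natAbs :=
    summable_inv_sqrt_two_pow_natAbs.tsum_pos (fun _ => by positivity) 0 (by simp)
  refine ⟨72 * C₀ * ∑' m : ℤ, (√2)⁻¹ ^ m.natAbs, by positivity, ?_⟩
  intro μ hμ A hA ψ hsupp hlip hzero a ha
  have := isFiniteMeasureOnCompacts_of_ball_le hμ
  have h : IsDyadicWavelet μ A ψ := ⟨hsupp, hlip, hzero⟩
  refine integral_norm_tsum_sq_le_of_forall_finset (fun Q z => a Q * ψ Q z)
    (mul_nonneg (by positivity) (tsum_nonneg fun _ => by positivity))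
    (fun Q => (h.continuous Q).measurable.const_mul _) (h.integrable_norm_sum_sq a) fun s => ?_
  refine (h.integral_norm_sum_sq_le hC₀ hμ hA a s).trans ?_
  gcongr
  exact ha.sum_le_tsum s fun _ _ => by positivity
end

section
/- Let μ be a C₀-good measure on ℂ, meaning μ is C₀-nice and the bilinear forms I_δ satisfy |I_δ(f,g)| ≤ C₀‖f‖_{L²(μ)}‖g‖_{L²(μ)} for all f,g ∈ L²(μ) and δ > 0, where I_δ(f,g) = ∬ K_δ(z−ξ)(1/2)(f(ξ)g(z)−f(z)g(ξ)) dμ(ξ)dμ(z). Then for all f, g ∈ L²(μ) the limit I(f,g) = lim_{δ→0} I_δ(f,g) exists, defines a bounded bilinear form with |I(f,g)| ≤ C₀‖f‖_{L²(μ)}‖g‖_{L²(μ)}, and hence there is a unique bounded linear operator 𝒞_μ on L²(μ) with ‖𝒞_μ‖ ≤ C₀ and ⟨𝒞_μ(f), g⟩_μ = I(f,g). -/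
open MeasureTheory Metric Filter

open scoped Topology ENNReal ComplexConjugate

section BilinearLimits

variable {ι E F : Type*} [NormedAddCommGroup E] [NormedSpace ℂ E] [NormedAddCommGroup F]
  [NormedSpace ℂ F] {l : Filter ι} [l.NeBot]

/-- A uniformly bounded family of functionals converging on a dense set converges pointwise. -/
lemma exists_tendsto_of_dense {A : ι → E →L[ℂ] ℂ} {C : ℝ}
    (hA : ∀ i x, ‖A i x‖ ≤ C * ‖x‖) {D : Set E} (hD : Dense D)
    (hlim : ∀ x ∈ D, ∃ c, Tendsto (fun i => A i x) l (𝓝 c)) (x : E) :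
    ∃ c, Tendsto (fun i => A i x) l (𝓝 c) := by
  rw [← cauchy_map_iff_exists_tendsto, Metric.cauchy_iff]
  refine ⟨inferInstance, fun ε hε => ?_⟩
  have hη : 0 < ε / (4 * (|C| + 1)) := by positivity
  obtain ⟨y, hyD, hy⟩ := hD.exists_dist_lt x hη
  obtain ⟨c, hc⟩ := hlim y hyD
  have hclose : ∀ i, dist (A i x) (A i y) < ε / 4 := fun i => by
    rw [dist_eq_norm, ← map_sub]
    rw [dist_eq_norm, lt_div_iff₀ (by positivity)] at hy
    have h1 := hA i (x - y)
    have h2 := mul_le_mul_of_nonneg_right (le_abs_self C) (norm_nonneg (x - y))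
    nlinarith [norm_nonneg (x - y)]
  refine ⟨ball c (ε / 2), ?_, fun a ha b hb => ?_⟩
  · rw [mem_map]
    filter_upwards [hc.eventually (ball_mem_nhds c (by positivity : 0 < ε / 4))] with i hi
    have := dist_triangle (A i x) (A i y) c
    have := hclose i
    simp only [Set.mem_preimage, mem_ball]
    linarith
  · rw [mem_ball] at ha hb
    linarith [dist_triangle_right a b c]

/-- A uniformly bounded family of bilinear forms converging on a dense set of pairs converges
pointwise to a bounded bilinear form. -/
lemma exists_bilinear_limit {A : ι → E →L[ℂ] F →L[ℂ] ℂ} {C : ℝ}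
    (hA : ∀ i x y, ‖A i x y‖ ≤ C * ‖x‖ * ‖y‖) {D : Set E} (hD : Dense D) {D' : Set F}
    (hD' : Dense D')
    (hlim : ∀ x ∈ D, ∀ y ∈ D', ∃ c, Tendsto (fun i => A i x y) l (𝓝 c)) :
    ∃ B : E →L[ℂ] F →L[ℂ] ℂ, (∀ x y, Tendsto (fun i => A i x y) l (𝓝 (B x y))) ∧
      ∀ x y, ‖B x y‖ ≤ C * ‖x‖ * ‖y‖ := by
  have hconv : ∀ x y, ∃ c, Tendsto (fun i => A i x y) l (𝓝 c) := fun x y =>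
    exists_tendsto_of_dense (A := fun i => (A i).flip y) (C := C * ‖y‖)
      (fun i x => by simpa [mul_right_comm] using hA i x y) hD
      (fun x hx => exists_tendsto_of_dense (fun i y => hA i x y) hD' (hlim x hx) y) x
  choose b hb using hconv
  have hbound : ∀ x y, ‖b x y‖ ≤ C * ‖x‖ * ‖y‖ := fun x y =>
    le_of_tendsto (hb x y).norm (Eventually.of_forall fun i => hA i x y)
  refine ⟨LinearMap.mkContinuous₂ (LinearMap.mk₂ ℂ b (fun x x' y => ?_) (fun c x y => ?_)
    (fun x y y' => ?_) (fun c x y => ?_)) C hbound, hb, hbound⟩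
  · exact tendsto_nhds_unique (hb _ _) (by simpa using (hb x y).add (hb x' y))
  · exact tendsto_nhds_unique (hb _ _) (by simpa using (hb x y).const_mul c)
  · exact tendsto_nhds_unique (hb _ _) (by simpa using (hb x y).add (hb x y'))
  · exact tendsto_nhds_unique (hb _ _) (by simpa using (hb x y).const_mul c)

end BilinearLimits

section Pairing

variable {α : Type*} [MeasurableSpace α] {μ : Measure α}

lemma integrable_Lp_two_mul (f g : Lp ℂ 2 μ) : Integrable (fun z => f z * g z) μ :=
  (Lp.memLp f).integrable_mul (Lp.memLp g)

lemma integral_mul_eq_inner_star (f g : Lp ℂ 2 μ) :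
    ∫ z, f z * g z ∂μ = inner ℂ (star f) g := by
  rw [L2.inner_def]
  refine integral_congr_ae ?_
  filter_upwards [Lp.coeFn_star f] with z hz
  simp [hz, mul_comm]

lemma integral_add_mul (f f' g : Lp ℂ 2 μ) :
    ∫ z, (f + f' : Lp ℂ 2 μ) z * g z ∂μ = ∫ z, f z * g z ∂μ + ∫ z, f' z * g z ∂μ := by
  rw [← integral_add (integrable_Lp_two_mul f g) (integrable_Lp_two_mul f' g)]
  refine integral_congr_ae ?_
  filter_upwards [Lp.coeFn_add f f'] with z hz
  rw [hz, Pi.add_apply, add_mul]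

lemma integral_smul_mul (c : ℂ) (f g : Lp ℂ 2 μ) :
    ∫ z, (c • f : Lp ℂ 2 μ) z * g z ∂μ = c * ∫ z, f z * g z ∂μ := by
  rw [← integral_const_mul]
  refine integral_congr_ae ?_
  filter_upwards [Lp.coeFn_smul c f] with z hz
  simp [hz, mul_assoc]

lemma eq_of_integral_mul_eq {f f' : Lp ℂ 2 μ}
    (h : ∀ g : Lp ℂ 2 μ, ∫ z, f z * g z ∂μ = ∫ z, f' z * g z ∂μ) : f = f' := by
  refine star_injective (ext_inner_right ℂ fun g => ?_)
  rw [← integral_mul_eq_inner_star, ← integral_mul_eq_inner_star, h]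

lemma norm_star_Lp (f : Lp ℂ 2 μ) : ‖star f‖ = ‖f‖ := by
  rw [Lp.norm_def, Lp.norm_def, eLpNorm_congr_ae (Lp.coeFn_star f), eLpNorm_star]

/-- A bounded bilinear form on `L²` is represented, through the bilinear pairing `∫ f g`, by a
unique bounded operator. -/
lemma existsUnique_operator_of_bilinear {B : Lp ℂ 2 μ →L[ℂ] Lp ℂ 2 μ →L[ℂ] ℂ} {C : ℝ}
    (hC : 0 ≤ C) (hB : ∀ f g, ‖B f g‖ ≤ C * ‖f‖ * ‖g‖) :
    ∃! T : Lp ℂ 2 μ →L[ℂ] Lp ℂ 2 μ, ‖T‖ ≤ C ∧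
      ∀ f g : Lp ℂ 2 μ, ∫ z, (T f : α → ℂ) z * g z ∂μ = B f g := by
  let t : Lp ℂ 2 μ → Lp ℂ 2 μ := fun f => star ((InnerProductSpace.toDual ℂ _).symm (B f))
  have ht : ∀ f g : Lp ℂ 2 μ, ∫ z, t f z * g z ∂μ = B f g := fun f g => by
    rw [integral_mul_eq_inner_star, star_star, InnerProductSpace.toDual_symm_apply]
  have hnorm : ∀ f, ‖t f‖ ≤ C * ‖f‖ := fun f => by
    rw [norm_star_Lp, LinearIsometryEquiv.norm_map]
    exact (B f).opNorm_le_bound (by positivity) (hB f)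
  let T : Lp ℂ 2 μ →ₗ[ℂ] Lp ℂ 2 μ :=
    { toFun := t
      map_add' := fun f f' => eq_of_integral_mul_eq fun g => by
        rw [integral_add_mul, ht, ht, ht, map_add, add_apply]
      map_smul' := fun c f => eq_of_integral_mul_eq fun g => by
        rw [RingHom.id_apply, integral_smul_mul, ht, ht, map_smul,
          smul_apply, smul_eq_mul] }
  refine ⟨T.mkContinuous C hnorm, ⟨T.mkContinuous_norm_le hC hnorm, ht⟩, ?_⟩
  rintro S ⟨-, hS⟩
  ext1 f
  exact eq_of_integral_mul_eq fun g => (hS f g).trans (ht f g).symm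

end Pairing

/-- The truncated Cauchy kernel `conj z / max(δ, |z|)²`. -/
noncomputable def truncatedCauchyKernel (δ : ℝ) (z : ℂ) : ℂ :=
  conj z / (max δ ‖z‖ : ℝ) ^ 2

/-- The truncated Cauchy transform of `f` with respect to `μ`. -/
noncomputable def truncatedCauchyTransform (μ : Measure ℂ) (δ : ℝ) (f : ℂ → ℂ) (z : ℂ) : ℂ :=
  ∫ ξ, truncatedCauchyKernel δ (z - ξ) * f ξ ∂μ

section Kernel

@[fun_prop]
lemma measurable_truncatedCauchyKernel (δ : ℝ) : Measurable (truncatedCauchyKernel δ) := by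
  unfold truncatedCauchyKernel
  exact (Complex.continuous_conj.measurable).div (by fun_prop)

lemma truncatedCauchyKernel_neg (δ : ℝ) (z : ℂ) :
    truncatedCauchyKernel δ (-z) = -truncatedCauchyKernel δ z := by
  simp [truncatedCauchyKernel, neg_div]

lemma norm_truncatedCauchyKernel_le {δ : ℝ} (hδ : 0 < δ) (z : ℂ) :
    ‖truncatedCauchyKernel δ z‖ ≤ (max δ ‖z‖)⁻¹ := by
  have hm : 0 < max δ ‖z‖ := lt_max_of_lt_left hδ
  rw [truncatedCauchyKernel, norm_div, norm_pow, Complex.norm_real, Real.norm_of_nonneg hm.le,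
    RCLike.norm_conj, div_le_iff₀ (by positivity), sq, inv_mul_cancel_left₀ hm.ne']
  exact le_max_right _ _

lemma norm_truncatedCauchyKernel_le_inv {δ : ℝ} (hδ : 0 < δ) (z : ℂ) :
    ‖truncatedCauchyKernel δ z‖ ≤ δ⁻¹ :=
  (norm_truncatedCauchyKernel_le hδ z).trans (inv_anti₀ hδ (le_max_left _ _))

lemma norm_truncatedCauchyKernel_mul_norm_le {δ : ℝ} (hδ : 0 < δ) (z : ℂ) :
    ‖truncatedCauchyKernel δ z‖ * ‖z‖ ≤ 1 := by
  have hm : 0 < max δ ‖z‖ := lt_max_of_lt_left hδ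
  calc ‖truncatedCauchyKernel δ z‖ * ‖z‖ ≤ (max δ ‖z‖)⁻¹ * max δ ‖z‖ := by
        gcongr
        · exact norm_truncatedCauchyKernel_le hδ z
        · exact le_max_right _ _
    _ = 1 := inv_mul_cancel₀ hm.ne'

lemma tendsto_truncatedCauchyKernel (z : ℂ) :
    Tendsto (fun δ => truncatedCauchyKernel δ z) (𝓝[>] 0) (𝓝 (truncatedCauchyKernel 0 z)) := by
  rcases eq_or_ne z 0 with rfl | hz
  · simp [truncatedCauchyKernel]
  · refine tendsto_const_nhds.congr' ?_
    filter_upwards [nhdsWithin_le_nhds (eventually_lt_nhds (norm_pos_iff.mpr hz))] with δ hδ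
    simp [truncatedCauchyKernel, max_eq_right hδ.le]

variable {μ : Measure ℂ} {C₀ : ℝ}

lemma isFiniteMeasureOnCompacts_of_linear_growth
    (hμ : ∀ (z : ℂ) (r : ℝ), 0 < r → μ (ball z r) ≤ ENNReal.ofReal (C₀ * r)) :
    IsFiniteMeasureOnCompacts μ where
  lt_top_of_isCompact K hK := by
    obtain ⟨r, hr⟩ := hK.isBounded.subset_ball_lt 0 0
    exact (measure_mono hr.2).trans_lt ((hμ 0 r hr.1).trans_lt ENNReal.ofReal_lt_top)

/-- Dyadic decomposition: linear growth makes the truncated kernel square integrable. -/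
lemma memLp_truncatedCauchyKernel
    (hμ : ∀ (z : ℂ) (r : ℝ), 0 < r → μ (ball z r) ≤ ENNReal.ofReal (C₀ * r))
    {δ : ℝ} (hδ : 0 < δ) (z : ℂ) :
    MemLp (fun ξ => truncatedCauchyKernel δ (z - ξ)) 2 μ := by
  have hmeas : Measurable fun ξ => truncatedCauchyKernel δ (z - ξ) := by fun_prop
  rw [memLp_two_iff_integrable_sq_norm hmeas.aestronglyMeasurable]
  refine ⟨(hmeas.norm.pow_const 2).aestronglyMeasurable, ?_⟩
  have hpt : ∀ ξ, ‖‖truncatedCauchyKernel δ (z - ξ)‖ ^ 2‖ₑ ≤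
      ∑' k : ℕ, (ball z (2 ^ (k + 1) * δ)).indicator
        (fun _ => ENNReal.ofReal (((2 ^ k * δ) ^ 2)⁻¹)) ξ := fun ξ => by
    have hm : 0 < max δ ‖z - ξ‖ := lt_max_of_lt_left hδ
    obtain ⟨k, hk₁, hk₂⟩ := exists_nat_pow_near
      ((one_le_div hδ).mpr (le_max_left δ ‖z - ξ‖)) one_lt_two
    rw [le_div_iff₀ hδ] at hk₁
    rw [div_lt_iff₀ hδ] at hk₂
    refine le_trans ?_ (ENNReal.le_tsum k)
    have hmem : ξ ∈ ball z (2 ^ (k + 1) * δ) := by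
      rw [mem_ball', dist_eq_norm]
      exact (le_max_right _ _).trans_lt hk₂
    rw [Set.indicator_of_mem hmem, Real.enorm_of_nonneg (by positivity)]
    refine ENNReal.ofReal_le_ofReal ?_
    rw [← inv_pow]
    gcongr
    exact (norm_truncatedCauchyKernel_le hδ _).trans (inv_anti₀ (by positivity) hk₁)
  have hsum : Summable fun k : ℕ => (2 * C₀ * δ⁻¹) * (1 / 2 : ℝ) ^ k :=
    summable_geometric_two.mul_left _
  calc ∫⁻ ξ, ‖‖truncatedCauchyKernel δ (z - ξ)‖ ^ 2‖ₑ ∂μ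
      ≤ ∫⁻ ξ, ∑' k : ℕ, (ball z (2 ^ (k + 1) * δ)).indicator
        (fun _ => ENNReal.ofReal (((2 ^ k * δ) ^ 2)⁻¹)) ξ ∂μ := lintegral_mono hpt
    _ = ∑' k : ℕ, ENNReal.ofReal (((2 ^ k * δ) ^ 2)⁻¹) * μ (ball z (2 ^ (k + 1) * δ)) := by
        rw [lintegral_tsum fun k => (measurable_const.indicator measurableSet_ball).aemeasurable]
        simp_rw [lintegral_indicator_const measurableSet_ball]
    _ ≤ ∑' k : ℕ, ENNReal.ofReal ((2 * C₀ * δ⁻¹) * (1 / 2 : ℝ) ^ k) := by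
        refine ENNReal.tsum_le_tsum fun k => ?_
        refine (mul_le_mul_right (hμ z (2 ^ (k + 1) * δ) (by positivity)) _).trans_eq ?_
        rw [← ENNReal.ofReal_mul (by positivity)]
        congr 1
        rw [one_div, inv_pow]
        field_simp
        ring
    _ < ∞ := hsum.tsum_ofReal_lt_top

lemma integrable_truncatedCauchyKernel_mul
    (hμ : ∀ (z : ℂ) (r : ℝ), 0 < r → μ (ball z r) ≤ ENNReal.ofReal (C₀ * r))
    {δ : ℝ} (hδ : 0 < δ) (f : Lp ℂ 2 μ) (z : ℂ) :
    Integrable (fun ξ => truncatedCauchyKernel δ (z - ξ) * f ξ) μ :=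
  (memLp_truncatedCauchyKernel hμ hδ z).integrable_mul (Lp.memLp f)

lemma aestronglyMeasurable_truncatedCauchyTransform [SFinite μ] (δ : ℝ) {f : ℂ → ℂ}
    (hf : AEStronglyMeasurable f μ) :
    AEStronglyMeasurable (truncatedCauchyTransform μ δ f) μ := by
  refine AEStronglyMeasurable.integral_prod_right'
    (f := fun p : ℂ × ℂ => truncatedCauchyKernel δ (p.1 - p.2) * f p.2) ?_
  exact (by fun_prop : Measurable fun p : ℂ × ℂ =>
    truncatedCauchyKernel δ (p.1 - p.2)).aestronglyMeasurable.mul hf.comp_snd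

lemma truncatedCauchyTransform_congr (δ : ℝ) {f g : ℂ → ℂ} (h : f =ᵐ[μ] g) :
    truncatedCauchyTransform μ δ f = truncatedCauchyTransform μ δ g := by
  funext z
  refine integral_congr_ae ?_
  filter_upwards [h] with ξ hξ
  rw [hξ]

lemma integral_antisymmetric_form_eq
    (hμ : ∀ (z : ℂ) (r : ℝ), 0 < r → μ (ball z r) ≤ ENNReal.ofReal (C₀ * r))
    {δ : ℝ} (hδ : 0 < δ) (f g : Lp ℂ 2 μ) (z : ℂ) :
    ∫ ξ, truncatedCauchyKernel δ (z - ξ) * ((1 / 2) * (f ξ * g z - f z * g ξ)) ∂μ =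
      (1 / 2) * (truncatedCauchyTransform μ δ f z * g z -
        f z * truncatedCauchyTransform μ δ g z) := by
  unfold truncatedCauchyTransform
  rw [← integral_mul_const, ← integral_const_mul, ← integral_sub, ← integral_const_mul]
  · congr 1 with ξ
    ring
  · exact (integrable_truncatedCauchyKernel_mul hμ hδ f z).mul_const _
  · exact (integrable_truncatedCauchyKernel_mul hμ hδ g z).const_mul _

end Kernel

/-- The truncated antisymmetrized Cauchy form. -/
noncomputable def truncatedCauchyForm (μ : Measure ℂ) (δ : ℝ) (f g : Lp ℂ 2 μ) : ℂ :=
  ∫ z, ∫ ξ, truncatedCauchyKernel δ (z - ξ) * ((1 / 2) * (f ξ * g z - f z * g ξ)) ∂μ ∂μ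

section Form

variable {μ : Measure ℂ} {C₀ : ℝ}

lemma integrable_truncatedCauchyKernel_mul_mul [SFinite μ] {δ : ℝ} (hδ : 0 < δ) {f g : ℂ → ℂ}
    (hf : Integrable f μ) (hg : Integrable g μ) :
    Integrable (fun p : ℂ × ℂ => truncatedCauchyKernel δ (p.1 - p.2) * (g p.1 * f p.2))
      (μ.prod μ) :=
  (hg.mul_prod hf).bdd_mul
    (by fun_prop : Measurable fun p : ℂ × ℂ =>
      truncatedCauchyKernel δ (p.1 - p.2)).aestronglyMeasurable
    (Eventually.of_forall fun _ => norm_truncatedCauchyKernel_le_inv hδ _)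

lemma integrable_truncatedCauchyTransform_mul [SFinite μ] {δ : ℝ} (hδ : 0 < δ) {f g : ℂ → ℂ}
    (hf : Integrable f μ) (hg : Integrable g μ) :
    Integrable (fun z => truncatedCauchyTransform μ δ f z * g z) μ := by
  refine (integrable_truncatedCauchyKernel_mul_mul hδ hf hg).integral_prod_left.congr
    (Eventually.of_forall fun z => ?_)
  simp only [truncatedCauchyTransform]
  rw [← integral_mul_const]
  congr 1 with ξ
  ring

lemma integral_mul_truncatedCauchyTransform [SFinite μ] {δ : ℝ} (hδ : 0 < δ) {f g : ℂ → ℂ}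
    (hf : Integrable f μ) (hg : Integrable g μ) :
    ∫ z, f z * truncatedCauchyTransform μ δ g z ∂μ =
      -∫ z, truncatedCauchyTransform μ δ f z * g z ∂μ := by
  have hswap := integral_integral_swap
    (f := fun z ξ => truncatedCauchyKernel δ (z - ξ) * (g z * f ξ))
    (integrable_truncatedCauchyKernel_mul_mul hδ hf hg)
  have hleft : ∀ z, ∫ ξ, truncatedCauchyKernel δ (z - ξ) * (g z * f ξ) ∂μ =
      truncatedCauchyTransform μ δ f z * g z := fun z => by
    rw [truncatedCauchyTransform, ← integral_mul_const]
    congr 1 with ξ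
    ring
  have hright : ∀ ξ, ∫ z, truncatedCauchyKernel δ (z - ξ) * (g z * f ξ) ∂μ =
      -(f ξ * truncatedCauchyTransform μ δ g ξ) := fun ξ => by
    rw [truncatedCauchyTransform, ← integral_const_mul, ← integral_neg]
    congr 1 with z
    rw [← neg_sub ξ z, truncatedCauchyKernel_neg]
    ring
  simp_rw [hleft, hright, integral_neg] at hswap
  rw [hswap, neg_neg]

lemma truncatedCauchyForm_eq_of_integrable [SFinite μ]
    (hμ : ∀ (z : ℂ) (r : ℝ), 0 < r → μ (ball z r) ≤ ENNReal.ofReal (C₀ * r))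
    {δ : ℝ} (hδ : 0 < δ) {f g : Lp ℂ 2 μ} (hf : Integrable f μ) (hg : Integrable g μ) :
    truncatedCauchyForm μ δ f g = ∫ z, truncatedCauchyTransform μ δ f z * g z ∂μ := by
  simp_rw [truncatedCauchyForm, integral_antisymmetric_form_eq hμ hδ]
  rw [integral_const_mul, integral_sub (integrable_truncatedCauchyTransform_mul hδ hf hg),
    integral_mul_truncatedCauchyTransform hδ hf hg]
  · ring
  · simpa [mul_comm] using integrable_truncatedCauchyTransform_mul hδ hg hf

lemma norm_truncatedCauchyTransform_le {δ : ℝ} (hδ : 0 < δ) {f : ℂ → ℂ}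
    (hf : Integrable f μ) (z : ℂ) :
    ‖truncatedCauchyTransform μ δ f z‖ ≤ δ⁻¹ * ∫ ξ, ‖f ξ‖ ∂μ := by
  rw [truncatedCauchyTransform, ← integral_const_mul]
  refine norm_integral_le_of_norm_le (hf.norm.const_mul _) (Eventually.of_forall fun ξ => ?_)
  rw [norm_mul]
  gcongr
  exact norm_truncatedCauchyKernel_le_inv hδ _

lemma memLp_indicator_truncatedCauchyTransform [SFinite μ] {δ : ℝ} (hδ : 0 < δ) {f : ℂ → ℂ}
    (hf : Integrable f μ) {s : Set ℂ} (hs : MeasurableSet s) (hμs : μ s < ∞) (p : ℝ≥0∞) :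
    MemLp (s.indicator (truncatedCauchyTransform μ δ f)) p μ := by
  rw [memLp_indicator_iff_restrict hs]
  have : IsFiniteMeasure (μ.restrict s) := ⟨by simpa using hμs⟩
  exact MemLp.of_bound (aestronglyMeasurable_truncatedCauchyTransform δ
    hf.aestronglyMeasurable).restrict _
    (Eventually.of_forall fun z => norm_truncatedCauchyTransform_le hδ hf z)

/-- Testing the form against the localized conjugate of the transform. -/
lemma eLpNorm_indicator_truncatedCauchyTransform_le [SFinite μ]
    (hμ : ∀ (z : ℂ) (r : ℝ), 0 < r → μ (ball z r) ≤ ENNReal.ofReal (C₀ * r))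
    (hC₀ : 0 ≤ C₀) {δ : ℝ} (hδ : 0 < δ)
    (hb : ∀ f g : Lp ℂ 2 μ, ‖truncatedCauchyForm μ δ f g‖ ≤ C₀ * ‖f‖ * ‖g‖)
    {f : Lp ℂ 2 μ} (hf : Integrable f μ) {s : Set ℂ} (hs : MeasurableSet s) (hμs : μ s < ∞) :
    eLpNorm (s.indicator (truncatedCauchyTransform μ δ f)) 2 μ ≤
      ENNReal.ofReal (C₀ * ‖f‖) := by
  have hmem := memLp_indicator_truncatedCauchyTransform hδ hf hs hμs
  set h : Lp ℂ 2 μ := (hmem 2).toLp with hh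
  set g : Lp ℂ 2 μ := star h with hg
  have hh_ae : h =ᵐ[μ] s.indicator (truncatedCauchyTransform μ δ f) := (hmem 2).coeFn_toLp
  have hg_ae : g =ᵐ[μ] star (s.indicator (truncatedCauchyTransform μ δ f)) := by
    filter_upwards [Lp.coeFn_star h, hh_ae] with z hz hz'
    rw [hg, hz, Pi.star_apply, Pi.star_apply, hz']
  have hg_int : Integrable g μ :=
    (memLp_one_iff_integrable.mp (hmem 1).star).congr hg_ae.symm
  have hform : truncatedCauchyForm μ δ f g = (‖h‖ : ℂ) ^ 2 := by
    rw [truncatedCauchyForm_eq_of_integrable hμ hδ hf hg_int]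
    have : (‖h‖ : ℂ) ^ 2 = ∫ z, h z * g z ∂μ := by
      rw [integral_mul_eq_inner_star, ← hg, inner_self_eq_norm_sq_to_K, hg, norm_star_Lp]
      rfl
    rw [this]
    refine integral_congr_ae ?_
    filter_upwards [hh_ae, hg_ae] with z hz hz'
    rw [hz, hz']
    by_cases hzs : z ∈ s <;> simp [hzs]
  have hle : ‖h‖ ≤ C₀ * ‖f‖ := by
    have h1 := hb f g
    rw [hform, hg, norm_star_Lp, norm_pow, Complex.norm_real, norm_norm, sq] at h1
    rcases (norm_nonneg h).eq_or_lt with h0 | h0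
    · rw [← h0]
      positivity
    · exact le_of_mul_le_mul_right h1 h0
  rw [hh, Lp.norm_toLp] at hle
  exact (ENNReal.le_ofReal_iff_toReal_le (hmem 2).eLpNorm_ne_top
    (ENNReal.toReal_nonneg.trans hle)).mpr hle

lemma eLpNorm_truncatedCauchyTransform_le
    (hμ : ∀ (z : ℂ) (r : ℝ), 0 < r → μ (ball z r) ≤ ENNReal.ofReal (C₀ * r)) [SFinite μ]
    (hC₀ : 0 ≤ C₀) {δ : ℝ} (hδ : 0 < δ)
    (hb : ∀ f g : Lp ℂ 2 μ, ‖truncatedCauchyForm μ δ f g‖ ≤ C₀ * ‖f‖ * ‖g‖)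
    (f : Lp ℂ 2 μ) :
    eLpNorm (truncatedCauchyTransform μ δ f) 2 μ ≤ ENNReal.ofReal (C₀ * ‖f‖) := by
  let s : ℕ → Set ℂ := fun n => ball 0 (n + 1)
  have hs : ∀ n, MeasurableSet (s n) := fun n => measurableSet_ball
  have hμs : ∀ n, μ (s n) < ∞ := fun n =>
    (hμ 0 (n + 1) (by positivity)).trans_lt ENNReal.ofReal_lt_top
  have hmem : ∀ n, MemLp ((s n).indicator f) 2 μ := fun n => (Lp.memLp f).indicator (hs n)
  have hf_int : ∀ n, Integrable ((s n).indicator f) μ := fun n =>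
    memLp_one_iff_integrable.mp <| (hmem n).mono_exponent_of_measure_support_ne_top
      (fun x hx => Set.indicator_of_notMem hx f) (hμs n).ne one_le_two
  have hevent : ∀ z : ℂ, ∀ᶠ n in atTop, z ∈ s n := fun z => by
    filter_upwards [eventually_ge_atTop ⌈‖z‖⌉₊] with n hn
    rw [mem_ball_zero_iff]
    exact (Nat.ceil_le.mp hn).trans_lt (lt_add_one _)
  have hlim : ∀ z, Tendsto
      (fun n => (s n).indicator (truncatedCauchyTransform μ δ ((s n).indicator f)) z) atTop
      (𝓝 (truncatedCauchyTransform μ δ f z)) := fun z => by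
    have hT : Tendsto (fun n => truncatedCauchyTransform μ δ ((s n).indicator f) z) atTop
        (𝓝 (truncatedCauchyTransform μ δ f z)) := by
      refine tendsto_integral_of_dominated_convergence
        (fun ξ => ‖truncatedCauchyKernel δ (z - ξ) * f ξ‖) (fun n => ?_)
        (integrable_truncatedCauchyKernel_mul hμ hδ f z).norm (fun n => ?_) ?_
      · exact ((memLp_truncatedCauchyKernel hμ hδ z).integrable_mul (hmem n)).aestronglyMeasurable
      · refine Eventually.of_forall fun ξ => ?_
        rw [norm_mul, norm_mul]
        gcongr
        exact norm_indicator_le_norm_self _ _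
      · refine Eventually.of_forall fun ξ => tendsto_const_nhds.congr' ?_
        filter_upwards [hevent ξ] with n hn
        rw [Set.indicator_of_mem hn]
    refine hT.congr' ?_
    filter_upwards [hevent z] with n hn
    rw [Set.indicator_of_mem hn]
  refine (Lp.eLpNorm_lim_le_liminf_eLpNorm (fun n => ?_) _ (Eventually.of_forall hlim)).trans ?_
  · exact (aestronglyMeasurable_truncatedCauchyTransform δ
      (hf_int n).aestronglyMeasurable).indicator (hs n)
  · refine liminf_le_of_le (by isBoundedDefault) fun b hb' => ?_
    obtain ⟨n, hn⟩ := hb'.exists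
    refine hn.trans ?_
    have hfn : (hmem n).toLp =ᵐ[μ] (s n).indicator f := (hmem n).coeFn_toLp
    rw [← truncatedCauchyTransform_congr δ hfn]
    refine (eLpNorm_indicator_truncatedCauchyTransform_le hμ hC₀ hδ hb ((hf_int n).congr hfn.symm)
      (hs n) (hμs n)).trans ?_
    gcongr
    rw [Lp.norm_toLp, Lp.norm_def]
    exact ENNReal.toReal_mono (Lp.eLpNorm_ne_top f) (eLpNorm_indicator_le _)

/-- The truncated Cauchy form is a bounded bilinear form as soon as it is bounded. -/
lemma exists_bilinear_eq_truncatedCauchyForm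
    (hμ : ∀ (z : ℂ) (r : ℝ), 0 < r → μ (ball z r) ≤ ENNReal.ofReal (C₀ * r)) [SFinite μ]
    (hC₀ : 0 ≤ C₀) {δ : ℝ} (hδ : 0 < δ)
    (hb : ∀ f g : Lp ℂ 2 μ, ‖truncatedCauchyForm μ δ f g‖ ≤ C₀ * ‖f‖ * ‖g‖) :
    ∃ A : Lp ℂ 2 μ →L[ℂ] Lp ℂ 2 μ →L[ℂ] ℂ, ∀ f g, A f g = truncatedCauchyForm μ δ f g := by
  have hT : ∀ f : Lp ℂ 2 μ, MemLp (truncatedCauchyTransform μ δ f) 2 μ := fun f =>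
    ⟨aestronglyMeasurable_truncatedCauchyTransform δ (Lp.aestronglyMeasurable f),
      (eLpNorm_truncatedCauchyTransform_le hμ hC₀ hδ hb f).trans_lt ENNReal.ofReal_lt_top⟩
  let T : Lp ℂ 2 μ → Lp ℂ 2 μ := fun f => (hT f).toLp
  have hadd : ∀ f f' : Lp ℂ 2 μ, T (f + f') = T f + T f' := fun f f' => by
    simp only [T]
    rw [← MemLp.toLp_add]
    refine MemLp.toLp_congr _ _ (Eventually.of_forall fun z => ?_)
    rw [truncatedCauchyTransform_congr δ (Lp.coeFn_add f f'), Pi.add_apply]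
    simp only [truncatedCauchyTransform]
    rw [← integral_add (integrable_truncatedCauchyKernel_mul hμ hδ f z)
      (integrable_truncatedCauchyKernel_mul hμ hδ f' z)]
    simp_rw [Pi.add_apply, mul_add]
  have hsmul : ∀ (c : ℂ) (f : Lp ℂ 2 μ), T (c • f) = c • T f := fun c f => by
    simp only [T]
    rw [← MemLp.toLp_const_smul]
    refine MemLp.toLp_congr _ _ (Eventually.of_forall fun z => ?_)
    rw [truncatedCauchyTransform_congr δ (Lp.coeFn_smul c f), Pi.smul_apply]
    simp only [truncatedCauchyTransform]
    rw [smul_eq_mul, ← integral_const_mul]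
    simp_rw [Pi.smul_apply, smul_eq_mul, mul_left_comm]
  have hform : ∀ f g : Lp ℂ 2 μ, truncatedCauchyForm μ δ f g =
      (1 / 2) * (∫ z, T f z * g z ∂μ - ∫ z, T g z * f z ∂μ) := fun f g => by
    simp_rw [truncatedCauchyForm, integral_antisymmetric_form_eq hμ hδ]
    rw [integral_const_mul,
      ← integral_sub (integrable_Lp_two_mul _ _) (integrable_Lp_two_mul _ _)]
    congr 1
    refine integral_congr_ae ?_
    filter_upwards [(hT f).coeFn_toLp, (hT g).coeFn_toLp] with z hz hz'
    rw [hz, hz', mul_comm (f z)]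
  have hmul_add : ∀ f g g' : Lp ℂ 2 μ, ∫ z, f z * (g + g' : Lp ℂ 2 μ) z ∂μ =
      ∫ z, f z * g z ∂μ + ∫ z, f z * g' z ∂μ := fun f g g' => by
    simpa only [mul_comm] using integral_add_mul g g' f
  have hmul_smul : ∀ (c : ℂ) (f g : Lp ℂ 2 μ), ∫ z, f z * (c • g : Lp ℂ 2 μ) z ∂μ =
      c * ∫ z, f z * g z ∂μ := fun c f g => by
    simpa only [mul_comm (f _)] using integral_smul_mul c g f
  refine ⟨LinearMap.mkContinuous₂ (LinearMap.mk₂ ℂ (truncatedCauchyForm μ δ)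
    (fun f f' g => ?_) (fun c f g => ?_) (fun f g g' => ?_) (fun c f g => ?_)) C₀ hb,
    fun f g => rfl⟩
  · simp only [hform, hadd, integral_add_mul, hmul_add]
    ring
  · simp only [hform, hsmul, integral_smul_mul, hmul_smul, smul_eq_mul]
    ring
  · simp only [hform, hadd, integral_add_mul, hmul_add]
    ring
  · simp only [hform, hsmul, integral_smul_mul, hmul_smul, smul_eq_mul]
    ring

end Form

section Limit

variable {μ : Measure ℂ}

/-- The kernel singularity is absorbed by the antisymmetrization of Lipschitz functions. -/
lemma norm_truncatedCauchyKernel_mul_antisymm_le {u v : ℂ → ℂ} {Lu Lv : NNReal} {Mu Mv : ℝ}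
    (hu : LipschitzWith Lu u) (hv : LipschitzWith Lv v) (hMu : ∀ z, ‖u z‖ ≤ Mu)
    (hMv : ∀ z, ‖v z‖ ≤ Mv) {δ : ℝ} (hδ : 0 < δ) (z ξ : ℂ) :
    ‖truncatedCauchyKernel δ (z - ξ) * ((1 / 2) * (u ξ * v z - u z * v ξ))‖ ≤
      Lu * Mv + Mu * Lv := by
  have hMu₀ : 0 ≤ Mu := (norm_nonneg _).trans (hMu 0)
  have hMv₀ : 0 ≤ Mv := (norm_nonneg _).trans (hMv 0)
  have hdiff : ‖u ξ * v z - u z * v ξ‖ ≤ (Lu * Mv + Mu * Lv) * ‖z - ξ‖ :=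
    calc ‖u ξ * v z - u z * v ξ‖ = ‖(u ξ - u z) * v z + u z * (v z - v ξ)‖ := by
          congr 1
          ring
      _ ≤ ‖u ξ - u z‖ * ‖v z‖ + ‖u z‖ * ‖v z - v ξ‖ := by
          simpa only [norm_mul] using norm_add_le ((u ξ - u z) * v z) (u z * (v z - v ξ))
      _ ≤ (Lu * ‖z - ξ‖) * Mv + Mu * (Lv * ‖z - ξ‖) := by
          gcongr
          · rw [norm_sub_rev z ξ]
            exact hu.norm_sub_le _ _
          · exact hMv z
          · exact hMu z
          · exact hv.norm_sub_le _ _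
      _ = (Lu * Mv + Mu * Lv) * ‖z - ξ‖ := by ring
  calc ‖truncatedCauchyKernel δ (z - ξ) * ((1 / 2) * (u ξ * v z - u z * v ξ))‖
      = (1 / 2) * (‖truncatedCauchyKernel δ (z - ξ)‖ * ‖u ξ * v z - u z * v ξ‖) := by
        rw [norm_mul, norm_mul]
        norm_num
        ring
    _ ≤ 1 * (‖truncatedCauchyKernel δ (z - ξ)‖ * ((Lu * Mv + Mu * Lv) * ‖z - ξ‖)) := by
        gcongr
        norm_num
    _ = (‖truncatedCauchyKernel δ (z - ξ)‖ * ‖z - ξ‖) * (Lu * Mv + Mu * Lv) := by ring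
    _ ≤ 1 * (Lu * Mv + Mu * Lv) := by
        gcongr
        exact norm_truncatedCauchyKernel_mul_norm_le hδ _
    _ = Lu * Mv + Mu * Lv := one_mul _

lemma exists_tendsto_truncatedCauchyForm [SFinite μ] [IsFiniteMeasureOnCompacts μ]
    {f g : Lp ℂ 2 μ} {u v : ℂ → ℂ} (hfu : f =ᵐ[μ] u) (hgv : g =ᵐ[μ] v)
    (hu : HasCompactSupport u) (hv : HasCompactSupport v) {Lu Lv : NNReal}
    (hLu : LipschitzWith Lu u) (hLv : LipschitzWith Lv v) :
    ∃ c, Tendsto (fun δ => truncatedCauchyForm μ δ f g) (𝓝[>] 0) (𝓝 c) := by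
  obtain ⟨Mu, hMu⟩ := hLu.continuous.bounded_above_of_compact_support hu
  obtain ⟨Mv, hMv⟩ := hLv.continuous.bounded_above_of_compact_support hv
  let Φ : ℝ → ℂ × ℂ → ℂ := fun δ p =>
    truncatedCauchyKernel δ (p.1 - p.2) * ((1 / 2) * (u p.2 * v p.1 - u p.1 * v p.2))
  let S : Set ℂ := tsupport u ∪ tsupport v
  have hScompact : IsCompact S := hu.isCompact.union hv.isCompact
  have hSmeas : MeasurableSet S := hScompact.measurableSet
  let bound : ℂ × ℂ → ℝ := (S ×ˢ S).indicator fun _ => Lu * Mv + Mu * Lv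
  have hbound_int : Integrable bound (μ.prod μ) := by
    refine (integrable_indicator_iff (hSmeas.prod hSmeas)).mpr (integrableOn_const ?_)
    rw [Measure.prod_prod]
    exact (ENNReal.mul_lt_top hScompact.measure_lt_top hScompact.measure_lt_top).ne
  have hΦmeas : ∀ δ, AEStronglyMeasurable (Φ δ) (μ.prod μ) := fun δ => by
    have hum := hLu.continuous.measurable
    have hvm := hLv.continuous.measurable
    exact Measurable.aestronglyMeasurable (by fun_prop)
  have hΦbound : ∀ δ, 0 < δ → ∀ p, ‖Φ δ p‖ ≤ bound p := fun δ hδ p => by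
    by_cases hp : p ∈ S ×ˢ S
    · simp only [bound, Set.indicator_of_mem hp]
      exact norm_truncatedCauchyKernel_mul_antisymm_le hLu hLv hMu hMv hδ _ _
    · have hzero : ∀ z ∉ S, u z = 0 ∧ v z = 0 := fun z hz =>
        ⟨image_eq_zero_of_notMem_tsupport fun h => hz (Or.inl h),
          image_eq_zero_of_notMem_tsupport fun h => hz (Or.inr h)⟩
      simp only [bound, Set.indicator_of_notMem hp, Φ]
      rw [Set.mem_prod, not_and_or] at hp
      rcases hp with hp | hp <;> simp [hzero _ hp]
  have hform : ∀ δ, 0 < δ → ∫ p, Φ δ p ∂(μ.prod μ) = truncatedCauchyForm μ δ f g := fun δ hδ => by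
    rw [integral_prod _ (hbound_int.mono' (hΦmeas δ) (Eventually.of_forall (hΦbound δ hδ)))]
    refine integral_congr_ae ?_
    filter_upwards [hfu, hgv] with z hzf hzg
    refine integral_congr_ae ?_
    filter_upwards [hfu, hgv] with ξ hξf hξg
    simp only [Φ, hzf, hzg, hξf, hξg]
  refine ⟨∫ p, Φ 0 p ∂(μ.prod μ), Tendsto.congr' (f₁ := fun δ => ∫ p, Φ δ p ∂(μ.prod μ)) ?_ ?_⟩
  · filter_upwards [self_mem_nhdsWithin] with δ hδ using hform δ hδ
  · refine tendsto_integral_filter_of_dominated_convergence bound (Eventually.of_forall hΦmeas)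
      ?_ hbound_int (Eventually.of_forall fun p => ?_)
    · filter_upwards [self_mem_nhdsWithin] with δ hδ
      exact Eventually.of_forall (hΦbound δ hδ)
    · exact (tendsto_truncatedCauchyKernel _).mul_const _

end Limit

theorem cauchy_operator_exists (μ : Measure ℂ) (C₀ : ℝ) (hC₀ : 0 < C₀)
    (hnice : ∀ (z : ℂ) (r : ℝ), 0 < r → μ (ball z r) ≤ ENNReal.ofReal (C₀ * r))
    (Kδ : ℝ → ℂ → ℂ)
    (hKδ : ∀ (δ : ℝ) (z : ℂ), Kδ δ z = (starRingEnd ℂ) z / (max δ ‖z‖ : ℝ) ^ 2)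
    (Iδ : ℝ → Lp ℂ 2 μ → Lp ℂ 2 μ → ℂ)
    (hIδ : ∀ (δ : ℝ) (f g : Lp ℂ 2 μ), Iδ δ f g =
      ∫ z, ∫ ξ, Kδ δ (z - ξ) * ((1 / 2) * (f ξ * g z - f z * g ξ)) ∂μ ∂μ)
    (hbound : ∀ (δ : ℝ), 0 < δ → ∀ f g : Lp ℂ 2 μ, ‖Iδ δ f g‖ ≤ C₀ * ‖f‖ * ‖g‖) :
    ∃ I : Lp ℂ 2 μ → Lp ℂ 2 μ → ℂ,
      (∀ f g : Lp ℂ 2 μ,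
        Tendsto (fun δ => Iδ δ f g) (nhdsWithin 0 (Set.Ioi 0)) (nhds (I f g))) ∧
      (∀ f g : Lp ℂ 2 μ, ‖I f g‖ ≤ C₀ * ‖f‖ * ‖g‖) ∧
      (∃! T : Lp ℂ 2 μ →L[ℂ] Lp ℂ 2 μ, ‖T‖ ≤ C₀ ∧
        ∀ f g : Lp ℂ 2 μ, ∫ z, (T f : ℂ → ℂ) z * g z ∂μ = I f g) := by
  have hK : Kδ = truncatedCauchyKernel := by
    funext δ z
    exact hKδ δ z
  have hI : Iδ = truncatedCauchyForm μ := by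
    funext δ f g
    rw [hIδ, hK, truncatedCauchyForm]
  subst hI
  have := isFiniteMeasureOnCompacts_of_linear_growth hnice
  have hA : ∀ δ : ℝ, ∃ A : Lp ℂ 2 μ →L[ℂ] Lp ℂ 2 μ →L[ℂ] ℂ,
      (∀ f g, ‖A f g‖ ≤ C₀ * ‖f‖ * ‖g‖) ∧
        (0 < δ → ∀ f g, A f g = truncatedCauchyForm μ δ f g) := fun δ => by
    by_cases hδ : 0 < δ
    · obtain ⟨A, hA⟩ := exists_bilinear_eq_truncatedCauchyForm hnice hC₀.le hδ (hbound δ hδ)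
      exact ⟨A, fun f g => hA f g ▸ hbound δ hδ f g, fun _ => hA⟩
    · refine ⟨0, fun f g => ?_, fun h => absurd h hδ⟩
      simp only [zero_apply, norm_zero]
      positivity
  choose A hA_bound hA_eq using hA
  have hA_form : ∀ f g, (fun δ => A δ f g) =ᶠ[𝓝[>] 0] fun δ => truncatedCauchyForm μ δ f g :=
    fun f g => by
      filter_upwards [self_mem_nhdsWithin] with δ hδ using hA_eq δ hδ f g
  have hdense := Lp.dense_hasCompactSupport_contDiff (E := ℂ) (F := ℂ) (μ := μ)
    ENNReal.ofNat_ne_top (p := 2)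
  obtain ⟨B, hB_lim, hB_bound⟩ := exists_bilinear_limit (l := 𝓝[>] (0 : ℝ)) hA_bound hdense hdense
    (by
      rintro f ⟨u, hfu, hu, hu_smooth⟩ g ⟨v, hgv, hv, hv_smooth⟩
      obtain ⟨Lu, hLu⟩ := hu_smooth.lipschitzWith_of_hasCompactSupport hu (by simp)
      obtain ⟨Lv, hLv⟩ := hv_smooth.lipschitzWith_of_hasCompactSupport hv (by simp)
      obtain ⟨c, hc⟩ := exists_tendsto_truncatedCauchyForm hfu hgv hu hv hLu hLv
      exact ⟨c, hc.congr' (hA_form f g).symm⟩)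
  exact ⟨fun f g => B f g, fun f g => (hB_lim f g).congr' (hA_form f g), hB_bound,
    existsUnique_operator_of_bilinear hC₀.le hB_bound⟩
end
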